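/- Let π be a λ⊕⊸ proof of A₁, …, Aₙ ⊢ A₀ and let v be a valuation of the Boolean variables occurring in π (the labels of its ⊕†-rules). Then for every i ∈ {0, 1, …, n}, the slice v(B(π)) contains at least one pair one of whose members is an occurrence of an atom of A_i. -/

import Mathlib

/-- Formulas of the intuitionistic multiplicative-additive calculus λ⊕⊸:
atoms, labeled sums `⊕ₓ`, and linear implication `⊸`. -/
inductive Formula : Type
  | atom : ℕ → Formula
  | oplus : ℕ → Formula → Formula → Formula
  | limp : Formula → Formula → Formula
deriving DecidableEq

namespace Formula

/-- Number of atom occurrences of a formula. -/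
def size : Formula → ℕ
  | atom _ => 1
  | oplus _ A B => A.size + B.size
  | limp A B => A.size + B.size

/-- The list of Boolean-variable labels of the `⊕` occurrences of a formula. -/
def labels : Formula → List ℕ
  | atom _ => []
  | oplus x A B => x :: (A.labels ++ B.labels)
  | limp A B => A.labels ++ B.labels

end Formula

/-- Number of atom occurrences of a context. -/
def csz (Γ : List Formula) : ℕ := (Γ.map Formula.size).sum

/-- All labels of `⊕` occurrences of a sequent `Γ ⊢ C`. -/
def seqLabels (Γ : List Formula) (C : Formula) : List ℕ :=
  (Γ.map Formula.labels).flatten ++ C.labels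

/-- Cut-free, η-expanded sequent calculus proofs of λ⊕⊸. -/
inductive Proof : List Formula → Formula → Type
  | ax (a : ℕ) : Proof [.atom a] (.atom a)
  | limpR {Γ : List Formula} {A B : Formula} :
      Proof (Γ ++ [A]) B → Proof Γ (.limp A B)
  | limpL {Γ Δ : List Formula} {A B C : Formula} :
      Proof Γ A → Proof (B :: Δ) C → Proof (Γ ++ .limp A B :: Δ) C
  | ex (Γ₁ Γ₂ Γ₃ : List Formula) (A B : Formula) {C : Formula} :
      Proof (Γ₁ ++ A :: (Γ₂ ++ B :: Γ₃)) C → Proof (Γ₁ ++ B :: (Γ₂ ++ A :: Γ₃)) C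
  | oplusR1 (x : ℕ) {Γ : List Formula} {A B : Formula} :
      Proof Γ A → Proof Γ (.oplus x A B)
  | oplusR2 (x : ℕ) {Γ : List Formula} {A B : Formula} :
      Proof Γ B → Proof Γ (.oplus x A B)
  | oplusL (x : ℕ) {Γ : List Formula} {A B C : Formula} :
      Proof (Γ ++ [A]) C → Proof (Γ ++ [B]) C → Proof (Γ ++ [.oplus x A B]) C

/-- Atom occurrences of a sequent `Γ ⊢ C` are identified with the positions
`0, 1, 2, …` in the left-to-right flattening of `Γ` followed by `C`.
A slice is a finite set of unordered pairs of such positions. -/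
abbrev Slice := Finset (Sym2 ℕ)

/-- Reindexing the atom occurrences of a slice along a map of positions. -/
def Slice.reindex (f : ℕ → ℕ) (l : Slice) : Slice := l.image (Sym2.map f)

/-- Position reindex for the exchange rule: maps the positions of the layout
`[a-block][p-block][b-block][q-block]rest` to those of `[a-block][q-block][b-block][p-block]rest`. -/
def swapMap (a p b q : ℕ) (i : ℕ) : ℕ :=
  if i < a then i
  else if i < a + p then i + q + b
  else if i < a + p + b then i - p + q
  else if i < a + p + b + q then i - p - b
  else i

/-- The slicing 𝒮(π) of a λ⊕⊸ proof. -/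
def Proof.slicing : {Γ : List Formula} → {C : Formula} → Proof Γ C → Finset Slice
  | _, _, .ax _ => {({s(0, 1)} : Slice)}
  | _, _, .limpR p => p.slicing
  | _, _, @Proof.limpL Γ _ A _ _ p q =>
      Finset.image₂ (fun l m => l ∪ Slice.reindex (fun i => i + (csz Γ + A.size)) m)
        p.slicing q.slicing
  | _, _, @Proof.ex Γ₁ Γ₂ _ A B _ p =>
      p.slicing.image (Slice.reindex (swapMap (csz Γ₁) A.size (csz Γ₂) B.size))
  | _, _, .oplusR1 _ p => p.slicing
  | _, _, @Proof.oplusR2 _ Γ A _ p =>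
      p.slicing.image (Slice.reindex (fun i => if i < csz Γ then i else i + A.size))
  | _, _, @Proof.oplusL _ Γ A B _ p q =>
      p.slicing.image (Slice.reindex (fun i => if i < csz Γ + A.size then i else i + B.size))
      ∪ q.slicing.image (Slice.reindex (fun i => if i < csz Γ then i else i + A.size))

/-- Binary decision trees: leaves labeled `0`/`1` (as `Bool`), inner vertices labeled
by Boolean variables; `node x l r` has left subtree `l` and right subtree `r`. -/
inductive BDT : Type
  | leaf : Bool → BDT
  | node : ℕ → BDT → BDT → BDT
deriving DecidableEq

namespace BDT

/-- Evaluation of a BDT under a valuation: go left when the variable is `false` (0),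
right when it is `true` (1). -/
def eval (v : ℕ → Bool) : BDT → Bool
  | leaf b => b
  | node x l r => if v x then r.eval v else l.eval v

/-- Two BDTs are equivalent when they compute the same Boolean function. -/
def Equiv (φ ψ : BDT) : Prop := ∀ v : ℕ → Bool, φ.eval v = ψ.eval v

/-- Variables occurring in a BDT. -/
def vars : BDT → Finset ℕ
  | leaf _ => ∅
  | node x l r => insert x (l.vars ∪ r.vars)

/-- A BDT is free when no variable occurs twice on a path from the root to a leaf. -/
def Free : BDT → Prop
  | leaf _ => True
  | node x l r => x ∉ l.vars ∧ x ∉ r.vars ∧ l.Free ∧ r.Free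

/-- Negation of a BDT: swap the 0/1 labels at the leaves. -/
def neg : BDT → BDT
  | leaf b => leaf !b
  | node x l r => node x l.neg r.neg

end BDT

/-- The BDT slicing B(π) of a proof, as a function of two atom positions of the
conclusion sequent (it is symmetric in the two positions, and `0` on positions
that do not correspond to a pair of atoms of the sequent). -/
def Proof.bdt : {Γ : List Formula} → {C : Formula} → Proof Γ C → ℕ → ℕ → BDT
  | _, _, .ax _, i, j =>
      if (i = 0 ∧ j = 1) ∨ (i = 1 ∧ j = 0) then .leaf true else .leaf false
  | _, _, .limpR p, i, j => p.bdt i j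
  | _, _, @Proof.limpL Γ _ A _ _ p q, i, j =>
      if i < csz Γ + A.size ∧ j < csz Γ + A.size then p.bdt i j
      else if csz Γ + A.size ≤ i ∧ csz Γ + A.size ≤ j then
        q.bdt (i - (csz Γ + A.size)) (j - (csz Γ + A.size))
      else .leaf false
  | _, _, @Proof.ex Γ₁ Γ₂ _ A B _ p, i, j =>
      p.bdt (swapMap (csz Γ₁) B.size (csz Γ₂) A.size i)
            (swapMap (csz Γ₁) B.size (csz Γ₂) A.size j)
  | _, _, @Proof.oplusR1 _ Γ A _ p, i, j =>
      if i < csz Γ + A.size ∧ j < csz Γ + A.size then p.bdt i j else .leaf false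
  | _, _, @Proof.oplusR2 _ Γ A _ p, i, j =>
      if (i < csz Γ ∨ csz Γ + A.size ≤ i) ∧ (j < csz Γ ∨ csz Γ + A.size ≤ j) then
        p.bdt (if i < csz Γ then i else i - A.size) (if j < csz Γ then j else j - A.size)
      else .leaf false
  | _, _, @Proof.oplusL x Γ A B _ p q, i, j =>
      if ((csz Γ ≤ i ∧ i < csz Γ + A.size) ∧ (csz Γ + A.size ≤ j ∧ j < csz Γ + A.size + B.size)) ∨
         ((csz Γ ≤ j ∧ j < csz Γ + A.size) ∧ (csz Γ + A.size ≤ i ∧ i < csz Γ + A.size + B.size)) then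
        .leaf false
      else if (csz Γ ≤ i ∧ i < csz Γ + A.size) ∨ (csz Γ ≤ j ∧ j < csz Γ + A.size) then
        .node x (p.bdt (if i < csz Γ + A.size then i else i - B.size)
                       (if j < csz Γ + A.size then j else j - B.size)) (.leaf false)
      else if (csz Γ + A.size ≤ i ∧ i < csz Γ + A.size + B.size) ∨
              (csz Γ + A.size ≤ j ∧ j < csz Γ + A.size + B.size) then
        .node x (.leaf false) (q.bdt (if i < csz Γ then i else i - A.size)
                                     (if j < csz Γ then j else j - A.size))
      else
        .node x (p.bdt (if i < csz Γ + A.size then i else i - B.size)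
                       (if j < csz Γ + A.size then j else j - B.size))
                (q.bdt (if i < csz Γ then i else i - A.size)
                       (if j < csz Γ then j else j - A.size))

/-- Smaller element of an unordered pair of positions. -/
def pmin (p : Sym2 ℕ) : ℕ := Sym2.lift ⟨fun a b => min a b, fun a b => min_comm a b⟩ p
/-- Larger element of an unordered pair of positions. -/
def pmax (p : Sym2 ℕ) : ℕ := Sym2.lift ⟨fun a b => max a b, fun a b => max_comm a b⟩ p

/-- The BDT slicing B(π) at an unordered pair of atom positions. -/
def Proof.bdtAt {Γ : List Formula} {C : Formula} (π : Proof Γ C) (p : Sym2 ℕ) : BDT :=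
  π.bdt (pmin p) (pmax p)

/-- The slice obtained by evaluating the BDT slicing of `π` under a valuation `v`:
the set of pairs whose BDT evaluates to `1`. -/
def Proof.vslice {Γ : List Formula} {C : Formula} (π : Proof Γ C) (v : ℕ → Bool) :
    Set (Sym2 ℕ) :=
  {p : Sym2 ℕ | (π.bdtAt p).eval v = true}

/-- The labels of the `⊕†` rules of a proof (its Boolean variables). -/
def Proof.labels : {Γ : List Formula} → {C : Formula} → Proof Γ C → List ℕ
  | _, _, .ax _ => []
  | _, _, .limpR p => p.labels
  | _, _, .limpL p q => p.labels ++ q.labels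
  | _, _, .ex _ _ _ _ _ p => p.labels
  | _, _, .oplusR1 _ p => p.labels
  | _, _, .oplusR2 _ p => p.labels
  | _, _, .oplusL x p q => x :: (p.labels ++ q.labels)

/-- Number of rule occurrences of a proof. -/
def Proof.size : {Γ : List Formula} → {C : Formula} → Proof Γ C → ℕ
  | _, _, .ax _ => 1
  | _, _, .limpR p => p.size + 1
  | _, _, .limpL p q => p.size + q.size + 1
  | _, _, .ex _ _ _ _ _ p => p.size + 1
  | _, _, .oplusR1 _ p => p.size + 1
  | _, _, .oplusR2 _ p => p.size + 1
  | _, _, .oplusL x p q => p.size + q.size + 1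

theorem csz_nil : csz [] = 0 := rfl

theorem csz_cons (A : Formula) (Γ : List Formula) : csz (A :: Γ) = A.size + csz Γ := by
  simp [csz]

theorem csz_append (Γ Δ : List Formula) : csz (Γ ++ Δ) = csz Γ + csz Δ := by
  simp [csz]

theorem append_eq_append_cons_cases {α : Type*} {l₁ l₂ k₁ k₂ : List α} {a : α}
    (h : l₁ ++ l₂ = k₁ ++ a :: k₂) :
    (∃ k, l₁ = k₁ ++ a :: k ∧ k₂ = k ++ l₂) ∨ ∃ k, k₁ = l₁ ++ k ∧ l₂ = k ++ a :: k₂ := by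
  rcases List.append_eq_append_iff.1 h with ⟨k, rfl, h₂⟩ | ⟨k, rfl, h₂⟩
  · exact .inr ⟨k, rfl, h₂⟩
  · cases k with
    | nil => exact .inr ⟨[], by simp, by simpa using h₂.symm⟩
    | cons b k =>
      simp only [List.cons_append, List.cons.injEq] at h₂
      obtain ⟨rfl, rfl⟩ := h₂
      exact .inl ⟨k, rfl, rfl⟩

theorem Proof.bdt_symm {Γ : List Formula} {C : Formula} (π : Proof Γ C) (i j : ℕ) :
    π.bdt i j = π.bdt j i := by
  induction π generalizing i j with
  | ax a => simp only [Proof.bdt]; grind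
  | limpR p ih => exact ih i j
  | limpL p q ihp ihq => simp only [Proof.bdt]; grind
  | ex _ _ _ _ _ p ih => exact ih _ _
  | oplusR1 x p ih => simp only [Proof.bdt]; grind
  | oplusR2 x p ih => simp only [Proof.bdt]; grind
  | oplusL x p q ihp ihq =>
    simp only [Proof.bdt]
    rw [ihp, ihq]
    split_ifs <;> first | rfl | (exfalso; omega)

/-- Under the valuation `v`, some pair of positions below `n` evaluates to `1` in `f` and has
its first member in the block `[lo, hi)`. -/
def Hits (f : ℕ → ℕ → BDT) (v : ℕ → Bool) (n lo hi : ℕ) : Prop :=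
  ∃ i j, i < n ∧ j < n ∧ lo ≤ i ∧ i < hi ∧ (f i j).eval v = true

theorem Hits.map {f g : ℕ → ℕ → BDT} {v : ℕ → Bool} {n n' lo hi lo' hi' : ℕ}
    (h : Hits f v n lo hi) (e : ℕ → ℕ) (hn : ∀ i < n, e i < n')
    (hb : ∀ i < n, lo ≤ i → i < hi → lo' ≤ e i ∧ e i < hi')
    (he : ∀ i j, i < n → j < n → (g (e i) (e j)).eval v = (f i j).eval v) :
    Hits g v n' lo' hi' := by
  obtain ⟨i, j, hi, hj, h₁, h₂, h₃⟩ := h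
  exact ⟨e i, e j, hn i hi, hn j hj, (hb i hi h₁ h₂).1, (hb i hi h₁ h₂).2,
    (he i j hi hj).trans h₃⟩

theorem swapMap_swapMap (a p b q i : ℕ) : swapMap a q b p (swapMap a p b q i) = i := by
  unfold swapMap
  split_ifs <;> omega

theorem swapMap_lt {a p b q i n : ℕ} (hn : a + p + b + q ≤ n) (hi : i < n) :
    swapMap a p b q i < n := by
  unfold swapMap
  split_ifs <;> omega

theorem Proof.bdt_ex_swapMap {Γ₁ Γ₂ Γ₃ : List Formula} {A B C : Formula}
    (p : Proof (Γ₁ ++ A :: (Γ₂ ++ B :: Γ₃)) C) (i j : ℕ) :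
    (Proof.ex Γ₁ Γ₂ Γ₃ A B p).bdt (swapMap (csz Γ₁) A.size (csz Γ₂) B.size i)
      (swapMap (csz Γ₁) A.size (csz Γ₂) B.size j) = p.bdt i j := by
  simp only [Proof.bdt, swapMap_swapMap]

theorem Proof.bdt_limpL_left {Γ Δ : List Formula} {A B C : Formula} (p : Proof Γ A)
    (q : Proof (B :: Δ) C) {i j : ℕ} (hi : i < csz Γ + A.size) (hj : j < csz Γ + A.size) :
    (Proof.limpL p q).bdt i j = p.bdt i j := by
  simp only [Proof.bdt, hi, hj, and_self, if_true]

theorem Proof.bdt_limpL_right {Γ Δ : List Formula} {A B C : Formula} (p : Proof Γ A)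
    (q : Proof (B :: Δ) C) (i j : ℕ) :
    (Proof.limpL p q).bdt (csz Γ + A.size + i) (csz Γ + A.size + j) = q.bdt i j := by
  simp [Proof.bdt]

theorem Proof.bdt_oplusR1 {x : ℕ} {Γ : List Formula} {A B : Formula} (p : Proof Γ A) {i j : ℕ}
    (hi : i < csz Γ + A.size) (hj : j < csz Γ + A.size) :
    (Proof.oplusR1 (B := B) x p).bdt i j = p.bdt i j := by
  simp only [Proof.bdt, hi, hj, and_self, if_true]

/-- Make room for a block of `s` positions inserted at position `c`. -/
def insertBlock (c s i : ℕ) : ℕ := if i < c then i else i + s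

theorem Proof.bdt_oplusR2 {x : ℕ} {Γ : List Formula} {A B : Formula} (p : Proof Γ B) (i j : ℕ) :
    (Proof.oplusR2 (A := A) x p).bdt (insertBlock (csz Γ) A.size i)
      (insertBlock (csz Γ) A.size j) = p.bdt i j := by
  have h (k : ℕ) : insertBlock (csz Γ) A.size k < csz Γ ∨
      csz Γ + A.size ≤ insertBlock (csz Γ) A.size k := by
    unfold insertBlock; split_ifs <;> omega
  have h' (k : ℕ) : (if insertBlock (csz Γ) A.size k < csz Γ then insertBlock (csz Γ) A.size k
      else insertBlock (csz Γ) A.size k - A.size) = k := by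
    unfold insertBlock; split_ifs <;> omega
  simp only [Proof.bdt, h, h', and_self, if_true]

theorem Proof.eval_bdt_oplusL_left {x : ℕ} {Γ : List Formula} {A B C : Formula}
    (p : Proof (Γ ++ [A]) C) (q : Proof (Γ ++ [B]) C) {v : ℕ → Bool} (hv : v x = false)
    (i j : ℕ) :
    ((Proof.oplusL x p q).bdt (insertBlock (csz Γ + A.size) B.size i)
      (insertBlock (csz Γ + A.size) B.size j)).eval v = (p.bdt i j).eval v := by
  have h (k : ℕ) : ¬ (csz Γ + A.size ≤ insertBlock (csz Γ + A.size) B.size k ∧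
      insertBlock (csz Γ + A.size) B.size k < csz Γ + A.size + B.size) := by
    unfold insertBlock; split_ifs <;> omega
  have h' (k : ℕ) : (if insertBlock (csz Γ + A.size) B.size k < csz Γ + A.size then
      insertBlock (csz Γ + A.size) B.size k
      else insertBlock (csz Γ + A.size) B.size k - B.size) = k := by
    unfold insertBlock; split_ifs <;> omega
  simp only [Proof.bdt, h, h', and_false, or_self, if_false]
  split_ifs <;> simp [BDT.eval, hv]

theorem Proof.eval_bdt_oplusL_right {x : ℕ} {Γ : List Formula} {A B C : Formula}
    (p : Proof (Γ ++ [A]) C) (q : Proof (Γ ++ [B]) C) {v : ℕ → Bool} (hv : v x = true)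
    (i j : ℕ) :
    ((Proof.oplusL x p q).bdt (insertBlock (csz Γ) A.size i)
      (insertBlock (csz Γ) A.size j)).eval v = (q.bdt i j).eval v := by
  have h (k : ℕ) : ¬ (csz Γ ≤ insertBlock (csz Γ) A.size k ∧
      insertBlock (csz Γ) A.size k < csz Γ + A.size) := by
    unfold insertBlock; split_ifs <;> omega
  have h' (k : ℕ) : (if insertBlock (csz Γ) A.size k < csz Γ then insertBlock (csz Γ) A.size k
      else insertBlock (csz Γ) A.size k - A.size) = k := by
    unfold insertBlock; split_ifs <;> omega
  simp only [Proof.bdt, h, h', false_and, or_self, if_false]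
  split_ifs <;> simp [BDT.eval, hv]

/-- Every formula of the sequent is hit by the BDT slicing. -/
theorem Proof.hits {Γ : List Formula} {C : Formula} (π : Proof Γ C) (v : ℕ → Bool) :
    (∀ Γ₁ A Γ₂, Γ = Γ₁ ++ A :: Γ₂ →
      Hits π.bdt v (csz Γ + C.size) (csz Γ₁) (csz Γ₁ + A.size)) ∧
    Hits π.bdt v (csz Γ + C.size) (csz Γ) (csz Γ + C.size) := by
  induction π with
  | ax a =>
    refine ⟨fun Γ₁ A Γ₂ h => ?_, 1, 0, ?_⟩
    · obtain ⟨rfl, rfl, rfl⟩ : Γ₁ = [] ∧ A = .atom a ∧ Γ₂ = [] := by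
        cases Γ₁ <;> simp_all
      exact ⟨0, 1, by simp [csz, Formula.size, Proof.bdt, BDT.eval]⟩
    · simp [csz, Formula.size, Proof.bdt, BDT.eval]
  | @limpR Γ A B p ih =>
    simp only [csz_append, csz_cons, csz_nil, Formula.size] at ih ⊢
    refine ⟨fun Γ₁ D Γ₂ h => ?_, ?_⟩
    · exact (ih.1 Γ₁ D (Γ₂ ++ [A]) (by simp [h])).map id (by simp; omega) (by simp; omega)
        (fun _ _ _ _ => rfl)
    · exact ih.2.map id (by simp; omega) (by simp; omega) (fun _ _ _ _ => rfl)
  | @limpL Γ Δ A B C p q ihp ihq =>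
    simp only [csz_append, csz_cons, Formula.size] at ihp ihq ⊢
    refine ⟨fun Γ₁ D Γ₂ h => ?_, ?_⟩
    · rcases append_eq_append_cons_cases h with ⟨k, hk, -⟩ | ⟨k, rfl, hk⟩
      · exact (ihp.1 Γ₁ D k hk).map id (by simp; omega) (fun _ _ h₁ h₂ => ⟨h₁, h₂⟩)
          (fun i j hi hj => by rw [id, id, Proof.bdt_limpL_left p q hi hj])
      · cases k with
        | nil =>
          simp only [List.nil_append, List.cons.injEq] at hk
          obtain ⟨rfl, rfl⟩ := hk
          exact ihp.2.map id (by simp; omega) (by simp [Formula.size]; omega)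
            (fun i j hi hj => by rw [id, id, Proof.bdt_limpL_left p q hi hj])
        | cons E k =>
          simp only [List.cons_append, List.cons.injEq] at hk
          obtain ⟨rfl, rfl⟩ := hk
          refine (ihq.1 (B :: k) D Γ₂ rfl).map (fun i => csz Γ + A.size + i)
            (fun i hi => by simp only [csz_append, csz_cons] at hi ⊢; omega)
            (fun i hi h₁ h₂ => by
              simp only [csz_append, csz_cons, Formula.size] at h₁ h₂ ⊢; omega)
            (fun i j _ _ => by rw [Proof.bdt_limpL_right])
    · exact ihq.2.map (fun i => csz Γ + A.size + i) (fun i hi => by omega)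
        (fun i hi h₁ h₂ => by omega) (fun i j _ _ => by rw [Proof.bdt_limpL_right])
  | @ex Γ₁ Γ₂ Γ₃ A B C p ih =>
    have key {lo hi lo' hi' : ℕ}
        (h : Hits p.bdt v (csz (Γ₁ ++ A :: (Γ₂ ++ B :: Γ₃)) + C.size) lo hi)
        (hb : ∀ i, lo ≤ i → i < hi → lo' ≤ swapMap (csz Γ₁) A.size (csz Γ₂) B.size i ∧
          swapMap (csz Γ₁) A.size (csz Γ₂) B.size i < hi') :
        Hits (Proof.ex Γ₁ Γ₂ Γ₃ A B p).bdt v (csz (Γ₁ ++ B :: (Γ₂ ++ A :: Γ₃)) + C.size)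
          lo' hi' := by
      refine h.map (swapMap (csz Γ₁) A.size (csz Γ₂) B.size) (fun i hi => ?_)
        (fun i _ => hb i) (fun i j _ _ => by rw [Proof.bdt_ex_swapMap])
      simp only [csz_append, csz_cons] at hi ⊢
      exact swapMap_lt (by omega) (by omega)
    refine ⟨fun K₁ D K₂ h => ?_, ?_⟩
    · rcases append_eq_append_cons_cases h with ⟨k, rfl, -⟩ | ⟨k, rfl, hk⟩
      · refine key (ih.1 K₁ D (k ++ A :: (Γ₂ ++ B :: Γ₃)) (by simp)) (fun i h₁ h₂ => ?_)
        simp only [csz_append, csz_cons, swapMap] at h₁ h₂ ⊢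
        split_ifs <;> omega
      cases k with
      | nil =>
        simp only [List.nil_append, List.cons.injEq] at hk
        obtain ⟨rfl, -⟩ := hk
        refine key (ih.1 (Γ₁ ++ A :: Γ₂) B Γ₃ (by simp)) (fun i h₁ h₂ => ?_)
        simp only [csz_append, csz_cons, csz_nil, swapMap] at h₁ h₂ ⊢
        split_ifs <;> omega
      | cons E k =>
        simp only [List.cons_append, List.cons.injEq] at hk
        obtain ⟨rfl, hk⟩ := hk
        rcases append_eq_append_cons_cases hk with ⟨l, rfl, -⟩ | ⟨l, rfl, hl⟩
        · refine key (ih.1 (Γ₁ ++ A :: k) D (l ++ B :: Γ₃) (by simp)) (fun i h₁ h₂ => ?_)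
          simp only [csz_append, csz_cons, swapMap] at h₁ h₂ ⊢
          split_ifs <;> omega
        cases l with
        | nil =>
          simp only [List.nil_append, List.cons.injEq] at hl
          obtain ⟨rfl, -⟩ := hl
          refine key (ih.1 Γ₁ A (Γ₂ ++ B :: Γ₃) rfl) (fun i h₁ h₂ => ?_)
          simp only [csz_append, csz_cons, csz_nil, swapMap] at h₁ h₂ ⊢
          split_ifs <;> omega
        | cons F l =>
          simp only [List.cons_append, List.cons.injEq] at hl
          obtain ⟨rfl, rfl⟩ := hl
          refine key (ih.1 (Γ₁ ++ A :: (Γ₂ ++ B :: l)) D K₂ (by simp)) (fun i h₁ h₂ => ?_)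
          simp only [csz_append, csz_cons, swapMap] at h₁ h₂ ⊢
          split_ifs <;> omega
    · refine key ih.2 (fun i h₁ h₂ => ?_)
      simp only [csz_append, csz_cons, swapMap] at h₁ h₂ ⊢
      split_ifs <;> omega
  | @oplusR1 x Γ A B p ih =>
    simp only [Formula.size]
    refine ⟨fun Γ₁ D Γ₂ h => ?_, ?_⟩
    · exact (ih.1 Γ₁ D Γ₂ h).map id (by simp; omega) (fun _ _ h₁ h₂ => ⟨h₁, h₂⟩)
        (fun i j hi hj => by rw [id, id, Proof.bdt_oplusR1 p hi hj])
    · exact ih.2.map id (by simp; omega) (by simp; omega)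
        (fun i j hi hj => by rw [id, id, Proof.bdt_oplusR1 p hi hj])
  | @oplusR2 x Γ A B p ih =>
    simp only [Formula.size]
    refine ⟨fun Γ₁ D Γ₂ h => ?_, ?_⟩
    · refine (ih.1 Γ₁ D Γ₂ h).map (insertBlock (csz Γ) A.size) (fun i hi => ?_)
        (fun i hi h₁ h₂ => ?_) (fun i j _ _ => by rw [Proof.bdt_oplusR2])
      · unfold insertBlock; split_ifs <;> omega
      · simp only [h, csz_append, csz_cons, insertBlock]; split_ifs <;> omega
    · refine ih.2.map (insertBlock (csz Γ) A.size) (fun i hi => ?_)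
        (fun i hi h₁ h₂ => ?_) (fun i j _ _ => by rw [Proof.bdt_oplusR2]) <;>
      · unfold insertBlock; split_ifs <;> omega
  | @oplusL x Γ A B C p q ihp ihq =>
    simp only [csz_append, csz_cons, csz_nil, Formula.size, add_zero] at ihp ihq ⊢
    cases hv : v x with
    | false =>
      have key {lo hi lo' hi' : ℕ} (h : Hits p.bdt v (csz Γ + A.size + C.size) lo hi)
          (hb : ∀ i, lo ≤ i → i < hi → lo' ≤ insertBlock (csz Γ + A.size) B.size i ∧
            insertBlock (csz Γ + A.size) B.size i < hi') :
          Hits (Proof.oplusL x p q).bdt v (csz Γ + (A.size + B.size) + C.size) lo' hi' :=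
        h.map (insertBlock (csz Γ + A.size) B.size)
          (fun i hi => by unfold insertBlock; split_ifs <;> omega) (fun i _ => hb i)
          (fun i j _ _ => Proof.eval_bdt_oplusL_left p q hv i j)
      refine ⟨fun Γ₁ D Γ₂ h => ?_, key ihp.2 fun i h₁ h₂ => ?_⟩
      · rcases append_eq_append_cons_cases h with ⟨k, rfl, -⟩ | ⟨k, rfl, hk⟩
        · refine key (ihp.1 Γ₁ D (k ++ [A]) (by simp)) fun i h₁ h₂ => ?_
          simp only [csz_append, csz_cons, insertBlock]
          split_ifs <;> omega
        · obtain ⟨rfl, rfl⟩ : k = [] ∧ D = .oplus x A B := by cases k <;> simp_all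
          refine key (ihp.1 Γ A [] rfl) fun i h₁ h₂ => ?_
          simp only [List.append_nil, Formula.size, insertBlock]
          split_ifs <;> omega
      · unfold insertBlock; split_ifs <;> omega
    | true =>
      have key {lo hi lo' hi' : ℕ} (h : Hits q.bdt v (csz Γ + B.size + C.size) lo hi)
          (hb : ∀ i, lo ≤ i → i < hi → lo' ≤ insertBlock (csz Γ) A.size i ∧
            insertBlock (csz Γ) A.size i < hi') :
          Hits (Proof.oplusL x p q).bdt v (csz Γ + (A.size + B.size) + C.size) lo' hi' :=
        h.map (insertBlock (csz Γ) A.size)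
          (fun i hi => by unfold insertBlock; split_ifs <;> omega) (fun i _ => hb i)
          (fun i j _ _ => Proof.eval_bdt_oplusL_right p q hv i j)
      refine ⟨fun Γ₁ D Γ₂ h => ?_, key ihq.2 fun i h₁ h₂ => ?_⟩
      · rcases append_eq_append_cons_cases h with ⟨k, rfl, -⟩ | ⟨k, rfl, hk⟩
        · refine key (ihq.1 Γ₁ D (k ++ [B]) (by simp)) fun i h₁ h₂ => ?_
          simp only [csz_append, csz_cons, insertBlock]
          split_ifs <;> omega
        · obtain ⟨rfl, rfl⟩ : k = [] ∧ D = .oplus x A B := by cases k <;> simp_all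
          refine key (ihq.1 Γ B [] rfl) fun i h₁ h₂ => ?_
          simp only [List.append_nil, Formula.size, insertBlock]
          split_ifs <;> omega
      · unfold insertBlock; split_ifs <;> omega

theorem Proof.mk_mem_vslice {Γ : List Formula} {C : Formula} (π : Proof Γ C) (v : ℕ → Bool)
    (i j : ℕ) : s(i, j) ∈ π.vslice v ↔ (π.bdt i j).eval v = true := by
  change (π.bdt (min i j) (max i j)).eval v = true ↔ _
  rcases le_total i j with h | h
  · rw [min_eq_left h, max_eq_right h]
  · rw [min_eq_right h, max_eq_left h, π.bdt_symm]

/-- Let `π` be a λ⊕⊸ proof of `A₁, …, Aₙ ⊢ A₀` and `v` a valuation of its Boolean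
variables.  Then for every formula `Aᵢ` of the sequent (`i < n` indexing a context
formula, `i = n` the conclusion formula `A₀`), the slice `v(B(π))` contains at least
one pair one of whose members is an atom occurrence of `Aᵢ`, i.e. a position lying in
the block of positions occupied by `Aᵢ` in the flattening of the sequent. -/
theorem vslice_meets_every_formula
    (Γ : List Formula) (C : Formula) (hlab : (seqLabels Γ C).Nodup)
    (π : Proof Γ C) (v : ℕ → Bool) (i : ℕ) (hi : i ≤ Γ.length) :
    ∃ p ∈ π.vslice v, ∃ k ∈ p,
      csz (Γ.take i) ≤ k ∧
      k < csz (Γ.take i) + (if h : i < Γ.length then (Γ[i]'h).size else C.size) := by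
  obtain ⟨k, j, -, -, h₁, h₂, hv⟩ : Hits π.bdt v (csz Γ + C.size) (csz (Γ.take i))
      (csz (Γ.take i) + (if h : i < Γ.length then (Γ[i]'h).size else C.size)) := by
    split_ifs with h
    · exact (π.hits v).1 _ _ (Γ.drop (i + 1)) (by simp)
    · rw [List.take_of_length_le (not_lt.1 h)]
      exact (π.hits v).2
  exact ⟨s(k, j), (π.mk_mem_vslice v k j).2 hv, k, Sym2.mem_mk_left k j, h₁, h₂⟩
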